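/- Suppose m₁, m₂, n₁, n₂ are integers with n₁ > m₁ > 1, n₂ > m₂ > 1, m₁ ∣ n₁, m₂ ∣ n₂, and n₁/m₁ ≠ n₂/m₂, and moreover n₁/m₁ and n₂/m₂ have no common power (there are no positive integers k, l with (n₁/m₁)^k = (n₂/m₂)^l). Then BS(m₁,n₁) and BS(m₂,n₂) are not commensurable. -/

import Mathlib

def AbstractlyCommensurable (G : Type*) (H : Type*) [Group G] [Group H] : Prop :=
  ∃ (A : Subgroup G) (B : Subgroup H), A.FiniteIndex ∧ B.FiniteIndex ∧ Nonempty (A ≃* B)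

def BSRel (m n : ℤ) : Set (FreeGroup Bool) :=
  {(FreeGroup.of false)⁻¹ * FreeGroup.of true ^ m * FreeGroup.of false *
    (FreeGroup.of true ^ n)⁻¹}

abbrev BS (m n : ℤ) : Type := PresentedGroup (BSRel m n)

namespace HNNExtension

open NormalWord

variable {G : Type*} [Group G] {A B : Subgroup G} {φ : A ≃* B}

/-- The element of an HNN extension spelled by a list of syllables `t ^ u * g`. -/
def listProd (φ : A ≃* B) (l : List (ℤˣ × G)) : HNNExtension G A B φ :=
  (l.map (fun x => t ^ (x.1 : ℤ) * of x.2)).prod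

@[simp]
theorem listProd_nil : listProd φ [] = 1 := rfl

@[simp]
theorem listProd_cons (a : ℤˣ × G) (l : List (ℤˣ × G)) :
    listProd φ (a :: l) = t ^ (a.1 : ℤ) * of a.2 * listProd φ l := by
  simp [listProd]

@[simp]
theorem listProd_append (l l' : List (ℤˣ × G)) :
    listProd φ (l ++ l') = listProd φ l * listProd φ l' := by
  simp [listProd]

/-- The number of stable letters in a reduced word representing an element. -/
noncomputable def length (x : HNNExtension G A B φ) : ℕ :=
  (x • (empty : NormalWord (TransversalPair.nonempty G A B).some)).toList.length

theorem exists_reducedWord (x : HNNExtension G A B φ) :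
    ∃ w : ReducedWord G A B, x = of w.head * listProd φ w.toList ∧ w.toList.length = x.length := by
  refine ⟨(x • (empty : NormalWord (TransversalPair.nonempty G A B).some)).toReducedWord, ?_, rfl⟩
  change x = ReducedWord.prod φ _
  rw [prod_smul, prod_empty, mul_one]

theorem length_of_mul_listProd (g : G) (l : List (ℤˣ × G))
    (hl : l.IsChain (fun a b => a.2 ∈ toSubgroup A B a.1 → a.1 = b.1)) :
    (of g * listProd φ l).length = l.length := by
  obtain ⟨w, hw, hlen⟩ := exists_reducedWord (of g * listProd φ l)
  have h := (ReducedWord.map_fst_eq_and_of_prod_eq φ (w₁ := ⟨g, l, hl⟩) (w₂ := w) hw).1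
  rw [← hlen]
  simpa using (congrArg List.length h).symm

theorem length_unitsSMul_le {d : TransversalPair G A B} (u : ℤˣ) (w : NormalWord d) :
    (unitsSMul φ u w).toList.length ≤ w.toList.length + 1 := by
  unfold unitsSMul
  split_ifs with h
  · cases w using consRecOn with
    | ofGroup g => simp [Cancels] at h
    | cons g u' w h1 h2 _ =>
      simp only [unitsSMulWithCancel, consRecOn_cons, group_smul_toList, cons_toList,
        List.length_cons]
      lia
  · simp

theorem length_listProd_smul_le {d : TransversalPair G A B} (l : List (ℤˣ × G))
    (w : NormalWord d) : (listProd φ l • w).toList.length ≤ l.length + w.toList.length := by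
  induction l with
  | nil => simp
  | cons a l ih =>
    rw [listProd_cons, mul_smul, mul_smul, t_pow_smul_eq_unitsSMul, of_smul_eq_smul]
    refine (length_unitsSMul_le _ _).trans ?_
    simp only [group_smul_toList, List.length_cons]
    lia

theorem length_of_mul_listProd_le (g : G) (l : List (ℤˣ × G)) :
    (of g * listProd φ l).length ≤ l.length := by
  rw [length, mul_smul, of_smul_eq_smul, group_smul_toList]
  simpa using length_listProd_smul_le (φ := φ) l empty

theorem length_mul_le (x y : HNNExtension G A B φ) : (x * y).length ≤ x.length + y.length := by
  obtain ⟨w, hw, hlen⟩ := exists_reducedWord x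
  rw [← hlen]
  conv_lhs => rw [hw, length, mul_smul, mul_smul, of_smul_eq_smul, group_smul_toList]
  exact length_listProd_smul_le _ _

theorem t_zpow_mul_of_mul_t_zpow_neg (u : ℤˣ) {g : G} (hg : g ∈ toSubgroup A B u) :
    ∃ g' : G, t ^ (u : ℤ) * of g * t ^ ((-u : ℤˣ) : ℤ) = (of g' : HNNExtension G A B φ) := by
  rcases Int.units_eq_one_or u with rfl | rfl
  · exact ⟨φ ⟨g, hg⟩, by simp [equiv_eq_conj]⟩
  · exact ⟨φ.symm ⟨g, hg⟩, by simp [equiv_symm_eq_conj]⟩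

/-- A conjugate of minimal length of an element that is not conjugate into the base group is
cyclically reduced. -/
theorem exists_conj_length_pow (x : HNNExtension G A B φ)
    (hx : ∀ c g, x ≠ c * of g * c⁻¹) :
    ∃ c : HNNExtension G A B φ, ∃ n : ℕ, 0 < n ∧
      ∀ k : ℕ, ((c * x * c⁻¹) ^ k).length = k * n := by
  obtain ⟨c, hc⟩ : ∃ c, ∀ c', (c * x * c⁻¹).length ≤ (c' * x * c'⁻¹).length :=
    ⟨_, fun c' => Function.argmin_le (fun c => (c * x * c⁻¹).length) c'⟩
  obtain ⟨⟨h, l, hl⟩, hw, hlen⟩ := exists_reducedWord (c * x * c⁻¹)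
  dsimp only at hw hlen
  rcases l.eq_nil_or_concat' with rfl | ⟨l₀, ⟨u, g⟩, rfl⟩
  · refine absurd ?_ (hx c⁻¹ h)
    simp only [listProd_nil, mul_one] at hw
    rw [← hw]
    group
  set l := l₀ ++ [(u, g * h)] with hl_def
  have hl' : l.IsChain (fun a b => a.2 ∈ toSubgroup A B a.1 → a.1 = b.1) := by
    rw [List.isChain_append] at hl ⊢
    simpa using hl
  have hprod : (of h)⁻¹ * c * x * ((of h)⁻¹ * c)⁻¹ = listProd φ l := by
    calc _ = (of h)⁻¹ * (c * x * c⁻¹) * of h := by group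
      _ = _ := by rw [hw]; simp [hl_def, mul_assoc]
  have hcyc : ∀ b ∈ l.head?, g * h ∈ toSubgroup A B u → u = b.1 := by
    intro b hb hg
    by_contra hne
    rcases l₀ with - | ⟨a, l₁⟩
    · simp only [hl_def, List.nil_append, List.head?_cons, Option.mem_def,
        Option.some.injEq] at hb
      exact hne (by rw [← hb])
    simp only [hl_def, List.cons_append, List.head?_cons, Option.mem_def,
      Option.some.injEq] at hb
    subst hb
    obtain ⟨g', hg'⟩ := t_zpow_mul_of_mul_t_zpow_neg (φ := φ) u hg
    have ha : a.1 = -u := by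
      rw [Int.units_ne_iff_eq_neg.1 hne, neg_neg]
    have key := hc (t ^ (u : ℤ) * of (g * h) * ((of h)⁻¹ * c))
    have hz : t ^ (u : ℤ) * of (g * h) * ((of h)⁻¹ * c) * x *
        (t ^ (u : ℤ) * of (g * h) * ((of h)⁻¹ * c))⁻¹ = of (g' * a.2) * listProd φ l₁ := by
      calc _ = t ^ (u : ℤ) * of (g * h) * ((of h)⁻¹ * c * x * ((of h)⁻¹ * c)⁻¹) *
            (t ^ (u : ℤ) * of (g * h))⁻¹ := by group
        _ = t ^ (u : ℤ) * of (g * h) * t ^ ((-u : ℤˣ) : ℤ) * of a.2 * listProd φ l₁ := by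
          rw [hprod, hl_def, List.cons_append, listProd_cons, listProd_append, ha]
          simp only [listProd_cons, listProd_nil]
          group
        _ = _ := by rw [hg', map_mul]
    rw [hz, ← hlen] at key
    have := key.trans (length_of_mul_listProd_le _ _)
    simp at this
  refine ⟨(of h)⁻¹ * c, l.length, by simp [hl_def], fun k => ?_⟩
  obtain ⟨L, hL, -, hLprod, hLlen⟩ : ∃ L : List (ℤˣ × G),
      L.IsChain (fun a b => a.2 ∈ toSubgroup A B a.1 → a.1 = b.1) ∧
      (∀ b ∈ L.head?, b ∈ l.head?) ∧ listProd φ L = listProd φ l ^ k ∧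
      L.length = k * l.length := by
    induction k with
    | zero => exact ⟨[], by simp⟩
    | succ k ih =>
      obtain ⟨L, hL, hhead, hLprod, hLlen⟩ := ih
      refine ⟨l ++ L, List.isChain_append.2 ⟨hl', hL, ?_⟩, ?_, ?_, ?_⟩
      · intro a ha b hb
        have : a = (u, g * h) := by simpa [hl_def, eq_comm] using ha
        subst this
        exact hcyc b (hhead b hb)
      · simp [hl_def]
      · rw [listProd_append, hLprod, pow_succ']
      · rw [List.length_append, hLlen]
        ring
  rw [hprod, ← hLprod, ← hLlen]
  simpa using length_of_mul_listProd (φ := φ) 1 L hL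

/-- An element conjugate to a proper power of itself is conjugate into the base group. -/
theorem exists_eq_conj_of_of_conj_eq_pow {x s : HNNExtension G A B φ} {r : ℕ} (hr : 1 < r)
    (h : s⁻¹ * x * s = x ^ r) : ∃ c g, x = c * of g * c⁻¹ := by
  by_contra! hx
  obtain ⟨c, n, hn, hpow⟩ := exists_conj_length_pow x hx
  set y := c * x * c⁻¹ with hy
  set s' := c * s * c⁻¹ with hs'
  have hys : s'⁻¹ * y * s' = y ^ r := by
    rw [hy, conj_pow, ← h, hs']
    group
  have hbound (k : ℕ) : k * r * n ≤ s'⁻¹.length + k * n + s'.length := by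
    have hk : y ^ (k * r) = s'⁻¹ * y ^ k * s' := by
      rw [mul_comm, pow_mul, ← hys]
      simpa using conj_pow (a := s'⁻¹) (b := y) (i := k)
    rw [← hpow k, ← hpow (k * r), hk]
    exact (length_mul_le _ _).trans (Nat.add_le_add_right (length_mul_le _ _) _)
  have h1 := hbound (s'⁻¹.length + s'.length + 1)
  nlinarith [Nat.mul_le_mul_left ((s'⁻¹.length + s'.length + 1) * n) hr,
    Nat.mul_le_mul_left (s'⁻¹.length + s'.length + 1) hn]

end HNNExtension

namespace BS

variable {m n : ℤ}

/-- The generator `a` of `BS m n`. -/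
def a (m n : ℤ) : BS m n := PresentedGroup.of true

/-- The stable letter `t` of `BS m n`. -/
def t (m n : ℤ) : BS m n := PresentedGroup.of false

theorem rel (m n : ℤ) : (t m n)⁻¹ * a m n ^ m * t m n = a m n ^ n := by
  have h : PresentedGroup.mk (BSRel m n) ((FreeGroup.of false)⁻¹ * FreeGroup.of true ^ m *
      FreeGroup.of false * (FreeGroup.of true ^ n)⁻¹) = 1 :=
    PresentedGroup.one_of_mem rfl
  simp only [map_mul, map_inv, map_zpow] at h
  exact mul_inv_eq_one.1 h

/-- The homomorphism out of `BS m n` given by a solution of its relation. -/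
def lift {H : Type*} [Group H] (x y : H) (h : y⁻¹ * x ^ m * y = x ^ n) : BS m n →* H :=
  PresentedGroup.toGroup (f := fun b => cond b x y) (by
    rintro r rfl
    simp [h])

section lift

variable {H : Type*} [Group H] (x y : H) (h : y⁻¹ * x ^ m * y = x ^ n)

@[simp]
theorem lift_a : lift x y h (a m n) = x := PresentedGroup.toGroup.of _

@[simp]
theorem lift_t : lift x y h (t m n) = y := PresentedGroup.toGroup.of _

end lift

theorem hom_ext {H : Type*} [Group H] {f g : BS m n →* H} (ha : f (a m n) = g (a m n))
    (ht : f (t m n) = g (t m n)) : f = g :=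
  PresentedGroup.ext (by rintro (_ | _) <;> assumption)

/-- The action of `BS m n` on the rational line, with `a` acting as the unit translation and `t`
as the homothety of ratio `m / n`. -/
noncomputable def affine (hm : m ≠ 0) (hn : n ≠ 0) : BS m n →* Equiv.Perm ℚ :=
  lift (Equiv.addRight 1) (Equiv.mulRight₀ ((n : ℚ) / m)⁻¹ (by positivity)) (by
    have hm' : (m : ℚ) ≠ 0 := by positivity
    have hn' : (n : ℚ) ≠ 0 := by positivity
    ext x
    simp [Equiv.Perm.inv_def]
    field_simp)

theorem affine_a_zpow (hm : m ≠ 0) (hn : n ≠ 0) (k : ℤ) (x : ℚ) :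
    affine hm hn (a m n ^ k) x = x + k := by
  simp [affine]

theorem eq_zero_of_a_zpow_eq_one (hm : m ≠ 0) (hn : n ≠ 0) {k : ℤ} (h : a m n ^ k = 1) : k = 0 := by
  simpa [h, eq_comm] using affine_a_zpow hm hn k 0

theorem exists_affine_apply (hm : m ≠ 0) (hn : n ≠ 0) (g : BS m n) :
    ∃ (i : ℤ) (v : ℚ), ∀ x, affine hm hn g x = ((n : ℚ) / m) ^ i * x + v := by
  have hr : (n : ℚ) / m ≠ 0 := by positivity
  let S : Subgroup (BS m n) :=
    { carrier := {g | ∃ (i : ℤ) (v : ℚ), ∀ x, affine hm hn g x = ((n : ℚ) / m) ^ i * x + v}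
      one_mem' := ⟨0, 0, by simp⟩
      mul_mem' := by
        rintro g g' ⟨i, v, h⟩ ⟨i', v', h'⟩
        refine ⟨i + i', ((n : ℚ) / m) ^ i * v' + v, fun x => ?_⟩
        rw [map_mul, Equiv.Perm.mul_apply, h', h, zpow_add₀ hr]
        ring
      inv_mem' := by
        rintro g ⟨i, v, h⟩
        refine ⟨-i, -(((n : ℚ) / m) ^ (-i) * v), fun x => ?_⟩
        rw [map_inv, Equiv.Perm.inv_eq_iff_eq, h, zpow_neg]
        field_simp
        ring }
  refine PresentedGroup.generated_by _ S ?_ g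
  rintro (_ | _)
  · refine ⟨-1, 0, fun x => ?_⟩
    change affine hm hn (t m n) x = _
    simp [affine, mul_comm]
  · refine ⟨0, 1, fun x => ?_⟩
    change affine hm hn (a m n) x = _
    simpa using affine_a_zpow hm hn 1 x

/-- An element of `BS m n` conjugating a power of `a` into another scales it by a power of
`n / m`. -/
theorem exists_zpow_of_conj_a_zpow (hm : m ≠ 0) (hn : n ≠ 0) {s : BS m n} {p q : ℤ}
    (h : s⁻¹ * a m n ^ p * s = a m n ^ q) : ∃ i : ℤ, (p : ℚ) = ((n : ℚ) / m) ^ i * q := by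
  obtain ⟨i, v, hs⟩ := exists_affine_apply hm hn s
  have h' : a m n ^ p * s = s * a m n ^ q := by rw [← h]; group
  have := congrArg (fun g => affine hm hn g 0) h'
  simp only [map_mul, Equiv.Perm.mul_apply, affine_a_zpow, hs] at this
  exact ⟨i, by linarith⟩

/-- In `BS m n`, an element conjugate to a proper power of itself is conjugate to a power
of `a`. -/
theorem exists_eq_conj_a_zpow (hm : m ≠ 0) (hn : n ≠ 0) {x s : BS m n} {r : ℕ} (hr : 1 < r)
    (h : s⁻¹ * x * s = x ^ r) : ∃ (c : BS m n) (k : ℤ), x = c * a m n ^ k * c⁻¹ := by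
  have hinj {k : ℤ} (hk : k ≠ 0) :
      Function.Injective (zpowGroupHom k : Multiplicative ℤ →* Multiplicative ℤ) :=
    zpow_left_injective hk
  let φ := (MonoidHom.ofInjective (hinj hn)).symm.trans (MonoidHom.ofInjective (hinj hm))
  let α : Multiplicative ℤ := Multiplicative.ofAdd 1
  let f : BS m n →* HNNExtension (Multiplicative ℤ) _ _ φ :=
    lift (HNNExtension.of α) HNNExtension.t (by
      have h1 := HNNExtension.equiv_eq_conj (φ := φ) (MonoidHom.ofInjective (hinj hn) α)
      have h2 : ((φ (MonoidHom.ofInjective (hinj hn) α) : _) : Multiplicative ℤ) = α ^ m := by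
        simp [φ, MonoidHom.ofInjective_apply]
      rw [h2] at h1
      rw [← map_zpow, h1]
      simp [mul_assoc, MonoidHom.ofInjective_apply])
  let g : HNNExtension (Multiplicative ℤ) _ _ φ →* BS m n :=
    HNNExtension.lift (zpowersHom _ (a m n)) (t m n) (by
      intro b
      obtain ⟨z, rfl⟩ := (MonoidHom.ofInjective (hinj hn)).surjective b
      obtain ⟨k, rfl⟩ := Multiplicative.ofAdd.surjective z
      have h1 : t m n * a m n ^ (n * k) = a m n ^ (m * k) * t m n := by
        rw [zpow_mul, zpow_mul, ← rel m n]
        have := conj_zpow (a := (t m n)⁻¹) (b := a m n ^ m) (i := k)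
        rw [inv_inv] at this
        rw [this]
        group
      simpa [φ, MonoidHom.ofInjective_apply, zpowersHom_apply] using h1)
  have hgf : g.comp f = MonoidHom.id _ :=
    hom_ext (by simp [f, g, α]) (by simp [f, g])
  have hgf' (y : BS m n) : g (f y) = y := DFunLike.congr_fun hgf y
  obtain ⟨c, z, hz⟩ := HNNExtension.exists_eq_conj_of_of_conj_eq_pow (x := f x) (s := f s) hr
    (by rw [← map_pow, ← h]; simp)
  refine ⟨g c, z.toAdd, ?_⟩
  rw [← hgf' x, hz]
  simp [g]

/-- A nontrivial element of `BS m n` can only be conjugate to those of its proper powers whose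
exponent is a power of `n / m`. -/
theorem exists_eq_zpow_of_conj_eq_pow (hm : m ≠ 0) (hn : n ≠ 0) {x s : BS m n} (hx : x ≠ 1)
    {r : ℕ} (hr : 1 < r) (h : s⁻¹ * x * s = x ^ r) : ∃ i : ℤ, (r : ℚ) = ((n : ℚ) / m) ^ i := by
  obtain ⟨c, k, rfl⟩ := exists_eq_conj_a_zpow hm hn hr h
  have hk : (k : ℚ) ≠ 0 := by
    rintro hk
    simp [Int.cast_eq_zero.1 hk] at hx
  have hconj : (c⁻¹ * s * c)⁻¹ * a m n ^ k * (c⁻¹ * s * c) = a m n ^ (k * r) := by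
    calc _ = c⁻¹ * (s⁻¹ * (c * a m n ^ k * c⁻¹) * s) * c := by group
      _ = _ := by
        rw [h, conj_pow, zpow_mul, zpow_natCast]
        group
  obtain ⟨i, hi⟩ := exists_zpow_of_conj_a_zpow hm hn hconj
  refine ⟨-i, ?_⟩
  rw [zpow_neg]
  apply eq_inv_of_mul_eq_one_left
  push_cast at hi
  apply mul_left_cancel₀ hk
  linarith

theorem conj_t_pow {r : ℕ} (hn : n = m * r) (j : ℕ) :
    (t m n ^ j)⁻¹ * a m n ^ m * t m n ^ j = (a m n ^ m) ^ r ^ j := by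
  induction j with
  | zero => simp
  | succ j ih =>
    have h : (t m n)⁻¹ * a m n ^ m * t m n = (a m n ^ m) ^ r := by
      rw [rel, ← zpow_natCast, ← zpow_mul, ← hn]
    have hpow := conj_pow (a := (t m n)⁻¹) (b := a m n ^ m) (i := r ^ j)
    rw [inv_inv, h, ← pow_mul, ← pow_succ'] at hpow
    rw [hpow, ← ih, pow_succ]
    group

end BS

theorem BS_not_commensurable_ascending (m₁ n₁ m₂ n₂ : ℤ)
    (h₁ : 1 < m₁) (h₁' : m₁ < n₁) (h₂ : 1 < m₂) (h₂' : m₂ < n₂)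
    (hd₁ : m₁ ∣ n₁) (hd₂ : m₂ ∣ n₂)
    (hne : (n₁ : ℚ) / m₁ ≠ (n₂ : ℚ) / m₂)
    (hnopow : ¬ ∃ k l : ℕ, 0 < k ∧ 0 < l ∧
      ((n₁ : ℚ) / m₁) ^ k = ((n₂ : ℚ) / m₂) ^ l) :
    ¬ AbstractlyCommensurable (BS m₁ n₁) (BS m₂ n₂) := by
  rintro ⟨A, B, hA, -, ⟨e⟩⟩
  obtain ⟨r', hr'⟩ := hd₁
  have hr'1 : 1 < r' := by nlinarith
  lift r' to ℕ using by lia with r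
  have hr1 : 1 < r := by exact_mod_cast hr'1
  have hm₁ : (m₁ : ℚ) ≠ 0 := by exact_mod_cast (by lia : m₁ ≠ 0)
  have hratio : (n₁ : ℚ) / m₁ = r := by
    rw [hr']
    push_cast
    field_simp
  obtain ⟨k, hk, -, hkA⟩ := A.exists_pow_mem_of_index_ne_zero hA.index_ne_zero (BS.a m₁ n₁ ^ m₁)
  obtain ⟨j, hj, -, hjA⟩ := A.exists_pow_mem_of_index_ne_zero hA.index_ne_zero (BS.t m₁ n₁)
  let x : A := ⟨_, hkA⟩
  let s : A := ⟨_, hjA⟩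
  have hx : x ≠ 1 := by
    intro hx
    have hx' : (BS.a m₁ n₁ ^ m₁) ^ k = 1 := congrArg Subtype.val hx
    rw [← zpow_natCast, ← zpow_mul] at hx'
    have := BS.eq_zero_of_a_zpow_eq_one (by lia) (by lia) hx'
    simp at this
    lia
  have hconj : s⁻¹ * x * s = x ^ r ^ j := by
    apply Subtype.ext
    change (BS.t m₁ n₁ ^ j)⁻¹ * (BS.a m₁ n₁ ^ m₁) ^ k * BS.t m₁ n₁ ^ j =
      ((BS.a m₁ n₁ ^ m₁) ^ k) ^ r ^ j
    have hpow := conj_pow (a := (BS.t m₁ n₁ ^ j)⁻¹) (b := BS.a m₁ n₁ ^ m₁) (i := k)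
    rw [inv_inv] at hpow
    rw [← hpow, BS.conj_t_pow hr', ← pow_mul, ← pow_mul, mul_comm]
  have hrj : 1 < r ^ j := Nat.one_lt_pow (by lia) hr1
  obtain ⟨i, hi⟩ := BS.exists_eq_zpow_of_conj_eq_pow (m := m₂) (n := n₂) (by lia) (by lia)
    (x := (e x : BS m₂ n₂)) (s := (e s : BS m₂ n₂)) (by simpa using hx) hrj
    (by simpa using congrArg (fun y => (e y : BS m₂ n₂)) hconj)
  have hm₂ : (0 : ℚ) < m₂ := by exact_mod_cast (by lia : 0 < m₂)
  have hq : 1 < (n₂ : ℚ) / m₂ := (one_lt_div hm₂).2 (by exact_mod_cast h₂')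
  have hi0 : 0 < i := by
    rw [← one_lt_zpow_iff_right₀ hq, ← hi]
    exact_mod_cast hrj
  lift i to ℕ using hi0.le
  refine hnopow ⟨j, i, hj, by exact_mod_cast hi0, ?_⟩
  rw [hratio, ← zpow_natCast _ i, ← hi]
  push_cast
  rfl
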